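/- Let n ≥ 1 and let π be any n-cycle in S_n. Then the IO-polynomial F_π(z) is real-rooted, i.e., every complex root of F_π is real. -/

import Mathlib

open Finset Polynomial

/-- Number of cycles of a permutation, counting fixed points as cycles of length 1
(equivalently, the number of orbits). -/
noncomputable def cycleCount {α : Type*} [Fintype α] [DecidableEq α] (σ : Equiv.Perm α) : ℕ :=
  σ.cycleType.card + (Finset.univ.filter fun x => σ x = x).card

/-- The IO-polynomial `F_π(z) = Σ_{ζ ∈ Q_n} z^⌊(c(ζπ)-1)/2⌋`, where `Q_n` is the set of
`n`-cycles of `S_n` (i.e. permutations with a single cycle), and `ζπ` applies `ζ` first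
and then `π`. -/
noncomputable def IOPoly {n : ℕ} (π : Equiv.Perm (Fin n)) : Polynomial ℝ :=
  ∑ ζ ∈ Finset.univ.filter (fun ζ : Equiv.Perm (Fin n) => cycleCount ζ = 1),
    Polynomial.X ^ ((cycleCount (π * ζ) - 1) / 2)

section CycleCount

variable {α β : Type*} [Fintype α] [DecidableEq α] [Fintype β] [DecidableEq β]

open Equiv Equiv.Perm

theorem cycleCount_eq_card_quotient (σ : Perm α) :
    cycleCount σ = Nat.card (Quotient (SameCycle.setoid σ)) := by
  classical
  let F : Quotient (SameCycle.setoid σ) → Perm α ⊕ α := Quotient.lift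
    (fun x => if σ x = x then Sum.inr x else Sum.inl (σ.cycleOf x)) (by
      intro x y (h : SameCycle σ x y)
      by_cases hx : σ x = x
      · have : x = y := h.eq_of_left hx
        subst this; rfl
      · have hy : ¬ σ y = y := fun hy => hx (h.apply_eq_self_iff.2 hy)
        simp [hx, hy, h.cycleOf_eq])
  have hF : Function.Injective F := by
    intro a b
    induction a, b using Quotient.inductionOn₂ with | _ x y => ?_
    intro h
    apply Quotient.sound
    change SameCycle σ x y
    simp only [F, Quotient.lift_mk] at h
    split_ifs at h with hx hy hy
    · rw [Sum.inr.inj h]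
    · have h' := Sum.inl.inj h
      have : (σ.cycleOf y) x ≠ x := by
        rw [← h', cycleOf_apply_self]; exact hx
      by_contra hn
      exact this (cycleOf_apply_of_not_sameCycle (fun h => hn h.symm))
  have hr : Set.range F = ((σ.cycleFactorsFinset.disjSum
      (Finset.univ.filter fun x => σ x = x) : Finset (Perm α ⊕ α)) : Set (Perm α ⊕ α)) := by
    ext (c | x)
    · simp only [Set.mem_range, Finset.mem_coe, Finset.inl_mem_disjSum]
      constructor
      · rintro ⟨a, ha⟩
        induction a using Quotient.inductionOn with | _ x => ?_
        simp only [F, Quotient.lift_mk] at ha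
        split_ifs at ha with hx
        rw [← Sum.inl.inj ha, cycleOf_mem_cycleFactorsFinset_iff, mem_support]
        exact hx
      · intro hc
        obtain ⟨x, hx⟩ := (mem_cycleFactorsFinset_iff.1 hc).1.nonempty_support
        refine ⟨Quotient.mk _ x, ?_⟩
        have hx' := mem_cycleFactorsFinset_support_le hc hx
        rw [mem_support] at hx'
        simp only [F, Quotient.lift_mk, if_neg hx']
        rw [cycle_is_cycleOf hx hc]
    · simp only [Set.mem_range, Finset.mem_coe, Finset.inr_mem_disjSum, Finset.mem_filter,
        Finset.mem_univ, true_and]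
      constructor
      · rintro ⟨a, ha⟩
        induction a using Quotient.inductionOn with | _ y => ?_
        simp only [F, Quotient.lift_mk] at ha
        split_ifs at ha with hy
        rwa [← Sum.inr.inj ha]
      · intro hx
        exact ⟨Quotient.mk _ x, by simp [F, hx]⟩
  rw [← Nat.card_range_of_injective hF, hr, Nat.card_coe_set_eq, Set.ncard_coe_finset,
    Finset.card_disjSum, cycleCount, cycleType_def, Multiset.card_map]
  rfl

theorem card_invariant_bool (σ : Perm α) :
    Nat.card {f : α → Bool // ∀ x, f (σ x) = f x} = 2 ^ cycleCount σ := by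
  have hpow : ∀ f : α → Bool, (∀ x, f (σ x) = f x) → ∀ x y, SameCycle σ x y → f x = f y := by
    rintro f hf x y h
    obtain ⟨n, rfl⟩ := h.exists_nat_pow_eq
    induction n with
    | zero => rfl
    | succ n ih => rw [pow_succ', Perm.mul_apply, hf]; exact ih ⟨n, rfl⟩
  let e : {f : α → Bool // ∀ x, f (σ x) = f x} ≃ (Quotient (SameCycle.setoid σ) → Bool) :=
    { toFun := fun f => Quotient.lift f.1 (hpow f.1 f.2)
      invFun := fun g => ⟨fun x => g (Quotient.mk _ x), fun x => congrArg g
        (Quotient.sound (sameCycle_apply_left.2 (SameCycle.refl σ x)))⟩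
      left_inv := fun f => rfl
      right_inv := fun g => by
        ext a
        induction a using Quotient.inductionOn with | _ x => rfl }
  rw [Nat.card_congr e, Nat.card_fun, ← cycleCount_eq_card_quotient]
  simp

theorem cycleCount_eq_of_equiv {σ : Perm α} {τ : Perm β}
    (e : {f : α → Bool // ∀ x, f (σ x) = f x} ≃ {f : β → Bool // ∀ x, f (τ x) = f x}) :
    cycleCount σ = cycleCount τ := by
  apply Nat.pow_right_injective (le_refl 2)
  simp only [← card_invariant_bool, Nat.card_congr e]

theorem cycleCount_permCongr (e : α ≃ β) (σ : Perm α) :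
    cycleCount (e.permCongr σ) = cycleCount σ :=
  cycleCount_eq_of_equiv <|
    { toFun := fun f => ⟨fun x => f.1 (e x), fun x => by simpa using f.2 (e x)⟩
      invFun := fun f => ⟨fun x => f.1 (e.symm x), fun x => by simpa using f.2 (e.symm x)⟩
      left_inv := fun f => by ext; simp
      right_inv := fun f => by ext; simp }

theorem cycleCount_mul_comm (σ τ : Perm α) : cycleCount (σ * τ) = cycleCount (τ * σ) := by
  rw [← cycleCount_permCongr τ (σ * τ)]
  congr 1
  ext x
  simp

theorem cycleCount_pos [Nonempty α] (σ : Perm α) : 0 < cycleCount σ := by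
  rw [cycleCount_eq_card_quotient]
  have : Finite (Quotient (SameCycle.setoid σ)) := Quotient.finite _
  have : Nonempty (Quotient (SameCycle.setoid σ)) := ⟨Quotient.mk _ (Classical.arbitrary α)⟩
  exact Nat.card_pos

theorem cycleCount_optionCongr (τ : Perm α) :
    cycleCount (optionCongr τ : Perm (Option α)) = cycleCount τ + 1 := by
  apply Nat.pow_right_injective (le_refl 2)
  simp only [pow_succ, ← card_invariant_bool]
  let e : {f : Option α → Bool // ∀ x, f (optionCongr τ x) = f x} ≃
      {f : α → Bool // ∀ x, f (τ x) = f x} × Bool :=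
    { toFun := fun f => (⟨fun x => f.1 (some x), fun x => by simpa using f.2 (some x)⟩, f.1 none)
      invFun := fun p => ⟨fun o => o.elim p.2 p.1.1, by
        rintro (_ | x)
        · simp
        · simpa using p.1.2 x⟩
      left_inv := fun f => by ext (_ | x) <;> simp
      right_inv := fun p => by ext <;> simp }
  rw [Nat.card_congr e, Nat.card_prod]
  simp

theorem cycleCount_optionCongr_mul_swap (τ : Perm α) (x : α) :
    cycleCount (optionCongr τ * swap none (some x) : Perm (Option α)) = cycleCount τ := by
  refine cycleCount_eq_of_equiv
    { toFun := fun f => ⟨fun y => f.1 (some y), fun y => ?_⟩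
      invFun := fun g => ⟨fun o => o.elim (g.1 x) g.1, ?_⟩
      left_inv := fun f => ?_
      right_inv := fun g => ?_ }
  · have h0 := f.2 none
    have h1 := f.2 (some x)
    have h2 := f.2 (some y)
    by_cases hy : y = x
    · subst hy
      simp at h0 h1
      exact h0.trans h1
    · simpa [swap_apply_of_ne_of_ne, hy] using h2
  · rintro (_ | y)
    · simpa using g.2 x
    · by_cases hy : y = x
      · subst hy; simp
      · simpa [swap_apply_of_ne_of_ne, hy] using g.2 y
  · ext (_ | y)
    · have h1 := f.2 (some x)
      simp at h1
      simp [h1]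
    · simp
  · ext; simp

theorem cycleCount_swap_mul_optionCongr (τ : Perm α) (x : α) :
    cycleCount (swap none (some x) * optionCongr τ : Perm (Option α)) = cycleCount τ := by
  rw [cycleCount_mul_comm, cycleCount_optionCongr_mul_swap]

theorem sign_eq_neg_one_pow_cycleCount (σ : Perm α) :
    sign σ = (-1) ^ (Fintype.card α + cycleCount σ) := by
  have h1 : Fintype.card α = #σ.support + (Finset.univ.filter fun x => σ x = x).card := by
    rw [← Finset.card_univ, ← Finset.card_filter_add_card_filter_not (fun x => σ x ≠ x)]
    simp [Equiv.Perm.support]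
  rw [sign_of_cycleType, sum_cycleType, h1, cycleCount,
    show ∀ s f c : ℕ, s + f + (c + f) = s + c + 2 * f by intros; ring, pow_add _ _ (2 * _),
    pow_mul]
  simp

theorem even_card_add_cycleCount_mul {σ τ : Perm α} (hσ : cycleCount σ = 1)
    (hτ : cycleCount τ = 1) : Even (Fintype.card α + cycleCount (σ * τ)) := by
  have h := sign_mul σ τ
  simp only [sign_eq_neg_one_pow_cycleCount, hσ, hτ, ← mul_pow] at h
  simp only [mul_neg, mul_one, neg_neg, one_pow] at h
  by_contra hn
  rw [(Nat.not_even_iff_odd.1 hn).neg_one_pow] at h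
  exact absurd h (by decide)

end CycleCount

section CycleMatrix

open Equiv Matrix

theorem Matrix.derivative_det {ι R : Type*} [Fintype ι] [DecidableEq ι] [CommRing R]
    (A : Matrix ι ι R[X]) :
    derivative A.det = ∑ i, (A.updateCol i fun k => derivative (A k i)).det := by
  simp only [det_apply', derivative_sum, derivative_intCast_mul, derivative_prod_finset,
    Finset.mul_sum]
  rw [Finset.sum_comm]
  refine Finset.sum_congr rfl fun i _ => Finset.sum_congr rfl fun σ _ => ?_
  rw [← Finset.prod_erase_mul _ _ (Finset.mem_univ i)]
  congr 2
  · refine Finset.prod_congr rfl fun j hj => ?_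
    rw [updateCol_ne (Finset.ne_of_mem_erase hj)]
  · rw [updateCol_self]

theorem Matrix.det_option_of_none_row_eq_zero {ι R : Type*} [Fintype ι] [DecidableEq ι]
    [CommRing R]
    (A : Matrix (Option ι) (Option ι) R) (h : ∀ j, A none (some j) = 0) :
    A.det = A none none * (A.submatrix some some).det := by
  rw [← det_submatrix_equiv_self (optionEquivSumPUnit.{0} ι).symm A]
  have : A.submatrix (optionEquivSumPUnit.{0} ι).symm (optionEquivSumPUnit.{0} ι).symm =
      fromBlocks (A.submatrix some some) (of fun i _ => A (some i) none) 0
        (of fun _ _ : PUnit.{1} => A none none) := by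
    ext (i | i) (j | j) <;> simp [h]
  rw [this, det_fromBlocks_zero₂₁, mul_comm]
  simp

theorem Matrix.cramer_single_one {ι R : Type*} [Fintype ι] [DecidableEq ι] [CommRing R]
    (A : Matrix ι ι R) (i j : ι) : cramer A (Pi.single i 1) j = A.adjugate j i := by
  simp [cramer_eq_adjugate_mulVec]

/-- The matrix `1 - X P`, where `P` is the permutation matrix sending `e_j` to `e_{σ j}`. -/
noncomputable def oneSubXPerm {α : Type*} [DecidableEq α] (σ : Perm α) : Matrix α α ℂ[X] :=
  of fun i j => (if i = j then 1 else 0) - X * (if i = σ j then 1 else 0)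

theorem oneSubXPerm_apply {α : Type*} [DecidableEq α] (σ : Perm α) (i j : α) :
    oneSubXPerm σ i j = (if i = j then 1 else 0) - X * (if i = σ j then 1 else 0) := rfl

variable {α β : Type*} [Fintype α] [DecidableEq α] [Fintype β] [DecidableEq β]

theorem det_oneSubXPerm_permCongr (e : α ≃ β) (σ : Perm α) :
    (oneSubXPerm (e.permCongr σ)).det = (oneSubXPerm σ).det := by
  rw [← det_submatrix_equiv_self e]
  congr 1
  ext1 i j
  simp [oneSubXPerm_apply]

theorem det_oneSubXPerm_optionCongr (τ : Perm α) :
    (oneSubXPerm (optionCongr τ : Perm (Option α))).det = (1 - X) * (oneSubXPerm τ).det := by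
  rw [det_option_of_none_row_eq_zero]
  · congr 1
    · simp [oneSubXPerm_apply]
    · congr 1
      ext1 i j
      simp [oneSubXPerm_apply]
  · simp [oneSubXPerm_apply]

theorem det_oneSubXPerm_optionCongr_mul_swap (τ : Perm α) (x : α) :
    (oneSubXPerm (optionCongr τ * swap none (some x) : Perm (Option α))).det =
      X * (oneSubXPerm τ).det + (1 - X) * (oneSubXPerm τ).adjugate x x := by
  set B := oneSubXPerm (optionCongr τ * swap none (some x) : Perm (Option α)) with hB
  rw [← det_updateCol_add_smul_self B (show some x ≠ none by simp) X,
    det_option_of_none_row_eq_zero]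
  · have : (B.updateCol (some x) fun k => B k (some x) + (X : ℂ[X]) • B k none).submatrix
        some some = (oneSubXPerm τ).updateCol x ((X : ℂ[X]) • (fun k => oneSubXPerm τ k x) +
          (1 - X : ℂ[X]) • (Pi.single x 1 : α → ℂ[X])) := by
      ext1 i j
      by_cases hj : j = x
      · subst hj
        simp [hB, oneSubXPerm_apply, Pi.single_apply]
        split_ifs <;> ring
      · simp [hB, oneSubXPerm_apply, hj, swap_apply_of_ne_of_ne]
    rw [this, det_updateCol_add, det_updateCol_smul, det_updateCol_smul, updateCol_eq_self,
      ← cramer_apply, cramer_single_one]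
    simp [hB, oneSubXPerm_apply]
  · intro j
    by_cases hj : j = x
    · subst hj
      simp [hB, oneSubXPerm_apply]
    · simp [hB, oneSubXPerm_apply, hj, swap_apply_of_ne_of_ne]

theorem det_oneSubXPerm_mul_swap (τ : Perm α) {x a : α} (h : a ≠ x) :
    (oneSubXPerm (τ * swap x a)).det = -(oneSubXPerm τ).det + (oneSubXPerm τ).adjugate x x -
      (oneSubXPerm τ).adjugate x a + (oneSubXPerm τ).adjugate a a -
      (oneSubXPerm τ).adjugate a x := by
  set A := oneSubXPerm τ with hA
  let w : α → ℂ[X] := Pi.single x 1 - Pi.single a 1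
  have hperm : (oneSubXPerm (τ * swap x a)).submatrix id (swap x a) =
      (A.updateCol x ((fun k => A k x) - w)).updateCol a ((fun k => A k a) + w) := by
    ext1 i j
    by_cases ha : j = a
    · subst ha
      simp [hA, oneSubXPerm_apply, w, Pi.single_apply]
    · by_cases hx : j = x
      · subst hx
        simp [hA, oneSubXPerm_apply, w, Pi.single_apply, ha]
      · simp [hA, oneSubXPerm_apply, ha, hx, swap_apply_of_ne_of_ne]
  have hcomm : ∀ u v, (A.updateCol x u).updateCol a v = (A.updateCol a v).updateCol x u := by
    intro u v
    ext1 i j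
    simp only [updateCol_apply]
    split_ifs with h1 h2
    · exact absurd (h1.symm.trans h2) h
    all_goals rfl
  have hzero : ((A.updateCol a w).updateCol x w).det = 0 :=
    det_zero_of_column_eq h (fun i => by simp [updateCol_apply])
  have hcol : ((A.updateCol x ((fun k => A k x) - w)).updateCol a (fun k => A k a)) =
      A.updateCol x ((fun k => A k x) - w) := by
    ext1 i j
    simp only [updateCol_apply]
    split_ifs with h1 h2
    · exact absurd (h1.symm.trans h2) h
    · rw [h1]
    all_goals rfl
  have hcol' : ((A.updateCol a w).updateCol x (fun k => A k x)) = A.updateCol a w := by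
    rw [← hcomm, updateCol_eq_self]
  have hsub : ∀ (B : Matrix α α ℂ[X]) (u : α → ℂ[X]), (B.updateCol x (u - w)).det =
      (B.updateCol x u).det - (B.updateCol x w).det := by
    intro B u
    simp only [← cramer_apply, map_sub, Pi.sub_apply]
  have hdet := det_permute' (swap x a) (oneSubXPerm (τ * swap x a))
  rw [hperm, det_updateCol_add, hcol, hcomm, hsub, hsub, hcol', hzero, updateCol_eq_self,
    ← cramer_apply, ← cramer_apply, Perm.sign_swap h.symm] at hdet
  simp only [w, map_sub, Pi.sub_apply, cramer_single_one] at hdet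
  simp at hdet
  linear_combination hdet

theorem trace_adjugate_oneSubXPerm (τ : Perm α) :
    ∑ a, (oneSubXPerm τ).adjugate a a =
      (Fintype.card α : ℂ[X]) * (oneSubXPerm τ).det - X * derivative (oneSubXPerm τ).det := by
  have h : X * derivative (oneSubXPerm τ).det =
      ∑ i, ((oneSubXPerm τ).det - (oneSubXPerm τ).adjugate i i) := by
    rw [derivative_det, Finset.mul_sum]
    refine Finset.sum_congr rfl fun i _ => ?_
    rw [← det_updateCol_smul]
    have : ((X : ℂ[X]) • fun k => derivative (oneSubXPerm τ k i)) =
        (fun k => oneSubXPerm τ k i) - Pi.single i (1 : ℂ[X]) := by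
      ext1 k
      simp only [oneSubXPerm_apply, Pi.smul_apply, Pi.sub_apply, Pi.single_apply, smul_eq_mul]
      split_ifs <;> simp
    rw [this, ← cramer_apply, map_sub, Pi.sub_apply, cramer_single_one, cramer_apply,
      updateCol_eq_self]
  rw [h]
  simp

theorem one_sub_X_mul_sum_adjugate_row (τ : Perm α) (x : α) :
    (1 - X) * ∑ a, (oneSubXPerm τ).adjugate x a = (oneSubXPerm τ).det := by
  have h := congrFun (congrArg (fun B => B *ᵥ (fun _ => (1 : ℂ[X])))
    (adjugate_mul (oneSubXPerm τ))) x
  have h1 : oneSubXPerm τ *ᵥ (fun _ => (1 : ℂ[X])) = fun _ => 1 - X := by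
    ext1 i
    have : ∀ j, (i = τ j) = (τ.symm i = j) := fun j => by rw [Equiv.symm_apply_eq]
    simp [mulVec, dotProduct, oneSubXPerm_apply, Finset.sum_sub_distrib, this]
  simp only [← mulVec_mulVec, h1] at h
  simp [mulVec, dotProduct, Matrix.smul_apply, one_apply, ← Finset.sum_mul] at h
  rw [mul_comm, h]

theorem one_sub_X_mul_sum_adjugate_col (τ : Perm α) (x : α) :
    (1 - X) * ∑ a, (oneSubXPerm τ).adjugate a x = (oneSubXPerm τ).det := by
  have h := congrFun (congrArg (fun B => (fun _ => (1 : ℂ[X])) ᵥ* B)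
    (mul_adjugate (oneSubXPerm τ))) x
  have h1 : (fun _ => (1 : ℂ[X])) ᵥ* oneSubXPerm τ = fun _ => 1 - X := by
    ext1 i
    simp [vecMul, dotProduct, oneSubXPerm_apply, Finset.sum_sub_distrib]
  simp only [← vecMul_vecMul, h1] at h
  simp [vecMul, dotProduct, Matrix.smul_apply, one_apply, ← Finset.mul_sum] at h
  exact h

theorem sum_det_oneSubXPerm_mul_swap (τ : Perm α) (x : α) :
    ∑ a ∈ Finset.univ.erase x, (oneSubXPerm (τ * swap x a)).det =
      (oneSubXPerm τ).det + (Fintype.card α : ℂ[X]) * (oneSubXPerm τ).adjugate x x -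
        X * derivative (oneSubXPerm τ).det - 2 * ∑ a, (oneSubXPerm τ).adjugate x a := by
  have hne : (1 - X : ℂ[X]) ≠ 0 := sub_ne_zero.2 fun h => by
    simpa using congrArg (eval 0) h
  have hcol : ∑ a, (oneSubXPerm τ).adjugate a x = ∑ a, (oneSubXPerm τ).adjugate x a :=
    mul_left_cancel₀ hne <| by
      rw [one_sub_X_mul_sum_adjugate_row, one_sub_X_mul_sum_adjugate_col]
  have htr := trace_adjugate_oneSubXPerm τ
  rw [Finset.sum_congr rfl fun a ha => det_oneSubXPerm_mul_swap τ (Finset.ne_of_mem_erase ha)]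
  have hx := Finset.sum_erase_eq_sub (f := fun a => -(oneSubXPerm τ).det +
    (oneSubXPerm τ).adjugate x x - (oneSubXPerm τ).adjugate x a + (oneSubXPerm τ).adjugate a a -
      (oneSubXPerm τ).adjugate a x) (Finset.mem_univ x)
  rw [hx]
  simp only [Finset.sum_add_distrib, Finset.sum_sub_distrib, Finset.sum_const, Finset.card_univ,
    nsmul_eq_mul, hcol, htr]
  ring

theorem det_oneSubXPerm_of_cycleCount_eq_one {σ : Perm α} (h : cycleCount σ = 1) :
    (oneSubXPerm σ).det = 1 - X ^ Fintype.card α := by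
  have h1 : (∏ j, oneSubXPerm σ ((1 : Perm α) j) j) = ∏ j, (1 - X * (if j = σ j then 1 else 0)) :=
    Finset.prod_congr rfl fun j _ => by simp [oneSubXPerm_apply]
  obtain ⟨hc, hf⟩ | ⟨hc, hf⟩ := Nat.add_eq_one_iff.1 h
  · obtain rfl := Perm.card_cycleType_eq_zero.1 hc
    have hcard : Fintype.card α = 1 := by simpa using hf
    obtain ⟨x, hx⟩ := Fintype.card_eq_one_iff.1 hcard
    have : Unique α := ⟨⟨x⟩, hx⟩
    simp [det_unique, oneSubXPerm_apply]
  · have hcyc := Perm.card_cycleType_eq_one.1 hc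
    have hne : ∀ x, σ x ≠ x := fun x hx => by
      rw [Finset.card_eq_zero] at hf
      simpa [hx] using (Finset.ext_iff.1 hf) x
    rw [det_apply', Finset.sum_eq_add 1 σ hcyc.ne_one.symm]
    · have h2 : (∏ j, oneSubXPerm σ (σ j) j) = (-X) ^ Fintype.card α := by
        rw [← Finset.card_univ, ← Finset.prod_const]
        exact Finset.prod_congr rfl fun j _ => by simp [oneSubXPerm_apply, hne]
      have h3 : ∀ j, ¬ j = σ j := fun j hj => hne j hj.symm
      rw [h1, h2, sign_eq_neg_one_pow_cycleCount σ, h, neg_pow (X : ℂ[X])]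
      simp only [h3, if_false]
      have h4 : ((-1 : ℂ[X]) ^ Fintype.card α) * (-1) ^ Fintype.card α = 1 := by
        rw [← mul_pow]; simp
      push_cast
      simp only [Perm.sign_one, Units.val_one, Int.cast_one, mul_zero, sub_zero,
        Finset.prod_const_one, pow_succ]
      linear_combination (-X ^ Fintype.card α) * h4
    · rintro τ - ⟨hτ1, hτσ⟩
      suffices ∃ j, τ j ≠ j ∧ τ j ≠ σ j by
        obtain ⟨j, hj, hj'⟩ := this
        rw [Finset.prod_eq_zero (Finset.mem_univ j) (by simp [oneSubXPerm_apply, hj, hj']),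
          mul_zero]
      by_contra! hcon
      obtain ⟨x, hx⟩ : ∃ x, τ x ≠ x := by
        by_contra! hall
        exact hτ1 (Equiv.ext hall)
      refine hτσ (Equiv.ext fun y => ?_)
      obtain ⟨n, rfl⟩ := (hcyc.sameCycle (hne x) (hne y)).exists_nat_pow_eq
      induction n with
      | zero => exact hcon x hx
      | succ n ih =>
        rw [pow_succ', Perm.mul_apply]
        refine hcon _ fun hfix => hne ((σ ^ n) x) ?_
        exact τ.injective (hfix.trans ih.symm)
    · simp
    · simp

end CycleMatrix

section RisingFunctional

/-- The linear functional on polynomials sending `X ^ k` to `∏_{j = 0}^{N} (q - k + j)`. -/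
noncomputable def risingFunctional (q : ℂ) (N : ℕ) : ℂ[X] →ₗ[ℂ] ℂ :=
  Polynomial.lsum fun k => LinearMap.mulRight ℂ (∏ j ∈ Finset.range (N + 1), (q - k + j))

theorem risingFunctional_monomial (q : ℂ) (N k : ℕ) (c : ℂ) :
    risingFunctional q N (monomial k c) = c * ∏ j ∈ Finset.range (N + 1), (q - k + j) := by
  simp [risingFunctional, Polynomial.lsum]

theorem risingFunctional_succ_one_sub_X_mul (q : ℂ) (N : ℕ) (f : ℂ[X]) :
    risingFunctional q (N + 1) ((1 - X) * f) = (N + 2) * risingFunctional q N f := by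
  induction f using Polynomial.induction_on' with
  | add f g hf hg => rw [mul_add, map_add, hf, hg, map_add, mul_add]
  | monomial k c =>
    rw [sub_mul, one_mul, map_sub, X_mul_monomial, risingFunctional_monomial,
      risingFunctional_monomial, risingFunctional_monomial, Finset.prod_range_succ,
      Finset.prod_range_succ' _ (N + 1)]
    have : ∀ j : ℕ, q - ((k + 1 : ℕ) : ℂ) + ((j + 1 : ℕ) : ℂ) = q - k + j := fun j => by
      push_cast; ring
    simp only [this]
    push_cast
    ring

theorem risingFunctional_X_mul_derivative (q : ℂ) (N : ℕ) (f : ℂ[X]) :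
    risingFunctional q N (X * derivative f) =
      (q + N + 1) * risingFunctional q N f - risingFunctional q (N + 1) f := by
  induction f using Polynomial.induction_on' with
  | add f g hf hg => simp only [map_add, mul_add, hf, hg]; ring
  | monomial k c =>
    have : X * derivative (monomial k c) = monomial k (c * k) := by
      rw [derivative_monomial, X_mul_monomial]
      cases k <;> simp
    rw [this, risingFunctional_monomial, risingFunctional_monomial, risingFunctional_monomial,
      Finset.prod_range_succ _ (N + 1)]
    push_cast
    ring

theorem risingFunctional_one_sub_X_pow_ne_zero {q : ℂ} (hq : 0 < q.re) {N : ℕ} (hN : 1 ≤ N) :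
    risingFunctional q N (1 - X ^ N) ≠ 0 := by
  have h1 : risingFunctional q N 1 = ∏ j ∈ Finset.range (N + 1), (q + j) := by
    simpa using risingFunctional_monomial q N 0 1
  have h2 : risingFunctional q N (X ^ N) = ∏ j ∈ Finset.range (N + 1), (q - j) := by
    rw [← monomial_one_right_eq_X_pow, risingFunctional_monomial, one_mul,
      ← Finset.prod_range_reflect]
    refine Finset.prod_congr rfl fun j hj => ?_
    rw [show N + 1 - 1 - j = N - j by omega,
      Nat.cast_sub (Nat.lt_succ_iff.1 (Finset.mem_range.1 hj))]
    ring
  rw [map_sub, h1, h2, sub_ne_zero]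
  refine fun h => (ne_of_gt ?_) (congrArg norm h)
  have hle : ∀ j : ℕ, ‖q - j‖ ≤ ‖q + j‖ ∧ (1 ≤ j → ‖q - j‖ < ‖q + j‖) := by
    intro j
    have hre : (0 : ℝ) ≤ j := Nat.cast_nonneg j
    constructor
    · rw [← sq_le_sq₀ (norm_nonneg _) (norm_nonneg _), Complex.sq_norm, Complex.sq_norm,
        Complex.normSq_apply, Complex.normSq_apply]
      simp
      nlinarith
    · intro hj
      have hj : (1 : ℝ) ≤ j := by exact_mod_cast hj
      rw [← sq_lt_sq₀ (norm_nonneg _) (norm_nonneg _), Complex.sq_norm, Complex.sq_norm,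
        Complex.normSq_apply, Complex.normSq_apply]
      simp
      nlinarith
  have hpos : ∀ j : ℕ, 0 < ‖q + j‖ := fun j => by
    rw [norm_pos_iff]
    intro h0
    have := congrArg Complex.re h0
    simp at this
    have hre : (0 : ℝ) ≤ j := Nat.cast_nonneg j
    linarith
  rw [norm_prod, norm_prod, Finset.prod_range_succ, Finset.prod_range_succ]
  refine mul_lt_mul_of_le_of_lt_of_nonneg_of_pos ?_ ((hle N).2 hN) (norm_nonneg _) ?_
  · exact Finset.prod_le_prod (fun _ _ => norm_nonneg _) fun j _ => (hle j).1
  · exact Finset.prod_pos fun j _ => hpos j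

end RisingFunctional

section Enumeration

open Equiv

theorem optionCongr_mul {α : Type*} (σ τ : Perm α) :
    (optionCongr (σ * τ) : Perm (Option α)) = optionCongr σ * optionCongr τ := by
  ext1 (_ | x) <;> simp

theorem perm_option_cases {α : Type*} [DecidableEq α] (π : Perm (Option α)) :
    (∃ τ, π = optionCongr τ) ∨ ∃ τ x, π = optionCongr τ * swap none (some x) := by
  obtain ⟨⟨a, ζ⟩, h⟩ : ∃ p, (Perm.decomposeOption.symm p)⁻¹ = π :=
    ⟨Perm.decomposeOption π⁻¹, by rw [symm_apply_apply, inv_inv]⟩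
  have hinv : (optionCongr ζ : Perm (Option α))⁻¹ = optionCongr ζ⁻¹ := (optionCongr_symm ζ).symm
  rw [Perm.decomposeOption_symm_apply, mul_inv_rev, hinv, swap_inv] at h
  cases a with
  | none =>
    refine .inl ⟨ζ⁻¹, ?_⟩
    rw [← h, swap_self]
    rfl
  | some x => exact .inr ⟨ζ⁻¹, x, h.symm⟩

variable {α : Type*} [Fintype α] [DecidableEq α]

/-- The generating polynomial `∑ q ^ c(πζ)` over all full cycles `ζ`, evaluated at `q`. -/
noncomputable def fullCycleSum (q : ℂ) (π : Perm α) : ℂ :=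
  ∑ ζ with cycleCount ζ = 1, q ^ cycleCount (π * ζ)

theorem fullCycleSum_permCongr {β : Type*} [Fintype β] [DecidableEq β] (e : α ≃ β) (q : ℂ)
    (π : Perm α) : fullCycleSum q (e.permCongr π) = fullCycleSum q π := by
  simp only [fullCycleSum, Finset.sum_filter]
  rw [← Equiv.sum_comp e.permCongr]
  refine Finset.sum_congr rfl fun ζ _ => ?_
  rw [← permCongr_mul, cycleCount_permCongr, cycleCount_permCongr]

theorem sum_fullCycle_option [Nonempty α] (f : Perm (Option α) → ℂ) :
    ∑ ζ with cycleCount ζ = 1, f ζ =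
      ∑ a : α, ∑ ζ with cycleCount ζ = 1, f (swap none (some a) * optionCongr ζ) := by
  simp only [Finset.sum_filter]
  rw [← Equiv.sum_comp Perm.decomposeOption.symm, Fintype.sum_prod_type, Fintype.sum_option,
    Finset.sum_eq_zero, zero_add]
  · simp only [Perm.decomposeOption_symm_apply, cycleCount_swap_mul_optionCongr]
  · intro ζ _
    rw [if_neg]
    have := cycleCount_pos ζ
    simp only [Perm.decomposeOption_symm_apply, swap_self]
    rw [show (Equiv.refl (Option α)) * optionCongr ζ = optionCongr ζ from one_mul _,
      cycleCount_optionCongr]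
    omega

theorem fullCycleSum_optionCongr [Nonempty α] (q : ℂ) (τ : Perm α) :
    fullCycleSum q (optionCongr τ : Perm (Option α)) = Fintype.card α * fullCycleSum q τ := by
  rw [fullCycleSum, sum_fullCycle_option, fullCycleSum, ← nsmul_eq_mul, ← Finset.card_univ,
    ← Finset.sum_const]
  refine Finset.sum_congr rfl fun a _ => Finset.sum_congr rfl fun ζ _ => ?_
  rw [cycleCount_mul_comm, mul_assoc, ← optionCongr_mul, cycleCount_swap_mul_optionCongr,
    cycleCount_mul_comm]

theorem fullCycleSum_optionCongr_mul_swap [Nonempty α] (q : ℂ) (τ : Perm α) (x : α) :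
    fullCycleSum q (optionCongr τ * swap none (some x) : Perm (Option α)) =
      q * fullCycleSum q τ + ∑ a ∈ Finset.univ.erase x, fullCycleSum q (τ * swap x a) := by
  rw [fullCycleSum, sum_fullCycle_option, ← Finset.add_sum_erase _ _ (Finset.mem_univ x)]
  congr 1
  · rw [fullCycleSum, Finset.mul_sum]
    refine Finset.sum_congr rfl fun ζ _ => ?_
    rw [mul_assoc, swap_mul_self_mul, ← optionCongr_mul, cycleCount_optionCongr, pow_succ']
  · refine Finset.sum_congr rfl fun a ha => Finset.sum_congr rfl fun ζ _ => ?_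
    have hax := Finset.ne_of_mem_erase ha
    have h : (swap none (some x) * swap none (some a) : Perm (Option α)) =
        optionCongr (swap x a) * swap none (some x) := by
      rw [mul_swap_eq_swap_mul, swap_apply_left, swap_apply_of_ne_of_ne (by simp) (by simp [hax]),
        optionCongr_swap]
    rw [mul_assoc, ← mul_assoc (swap none (some x)), h, mul_assoc, ← mul_assoc, ← optionCongr_mul,
      ← mul_assoc, cycleCount_mul_comm, ← mul_assoc, ← optionCongr_mul,
      cycleCount_optionCongr_mul_swap, cycleCount_mul_comm]

theorem card_mul_fullCycleSum_optionCongr [Nonempty α] (q : ℂ) (τ : Perm α)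
    (h : (Fintype.card α : ℂ) * (Fintype.card α + 1) * fullCycleSum q τ =
      risingFunctional q (Fintype.card α) (oneSubXPerm τ).det) :
    ((Fintype.card α : ℂ) + 1) * (Fintype.card α + 2) *
        fullCycleSum q (optionCongr τ : Perm (Option α)) =
      risingFunctional q (Fintype.card α + 1)
        (oneSubXPerm (optionCongr τ : Perm (Option α))).det := by
  rw [det_oneSubXPerm_optionCongr, risingFunctional_succ_one_sub_X_mul, fullCycleSum_optionCongr,
    ← h]
  ring

theorem card_mul_fullCycleSum_optionCongr_mul_swap [Nonempty α] (q : ℂ)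
    (h : ∀ τ : Perm α, (Fintype.card α : ℂ) * (Fintype.card α + 1) * fullCycleSum q τ =
      risingFunctional q (Fintype.card α) (oneSubXPerm τ).det) (τ : Perm α) (x : α) :
    ((Fintype.card α : ℂ) + 1) * (Fintype.card α + 2) *
        fullCycleSum q (optionCongr τ * swap none (some x) : Perm (Option α)) =
      risingFunctional q (Fintype.card α + 1)
        (oneSubXPerm (optionCongr τ * swap none (some x) : Perm (Option α))).det := by
  have hcard : (Fintype.card α : ℂ) ≠ 0 := Nat.cast_ne_zero.2 Fintype.card_ne_zero
  have hsum := congrArg (risingFunctional q (Fintype.card α)) (sum_det_oneSubXPerm_mul_swap τ x)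
  simp only [map_sum, ← h, ← Finset.mul_sum] at hsum
  rw [det_oneSubXPerm_optionCongr_mul_swap, fullCycleSum_optionCongr_mul_swap]
  have hrow := one_sub_X_mul_sum_adjugate_row τ x
  set D := (oneSubXPerm τ).det
  set Q := (oneSubXPerm τ).adjugate x x
  set H := ∑ a, (oneSubXPerm τ).adjugate x a
  set Φ := risingFunctional q
  set N := Fintype.card α
  have hD : Φ (N + 1) D = (N + 2) * Φ N H := by
    rw [← hrow, risingFunctional_succ_one_sub_X_mul]
  have hXD : Φ (N + 1) (X * D) = Φ (N + 1) D - (N + 2) * Φ N D := by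
    rw [← risingFunctional_succ_one_sub_X_mul, ← map_sub]
    congr 1
    ring
  have hQ : Φ (N + 1) ((1 - X) * Q) = (N + 2) * Φ N Q := risingFunctional_succ_one_sub_X_mul ..
  have hder : Φ N (X * derivative D) = (q + N + 1) * Φ N D - Φ (N + 1) D :=
    risingFunctional_X_mul_derivative ..
  have hNQ : Φ N ((N : ℂ[X]) * Q) = N * Φ N Q := by
    rw [← nsmul_eq_mul, map_nsmul, nsmul_eq_mul]
  have hH : Φ N (2 * H) = 2 * Φ N H := by
    rw [two_mul, map_add, two_mul]
  rw [map_sub, map_sub, map_add, hNQ, hder, hH, hD] at hsum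
  apply mul_left_cancel₀ hcard
  rw [map_add, hXD, hQ, hD]
  linear_combination (N + 2 : ℂ) * hsum + (N + 2 : ℂ) * q * h τ

theorem fullCycleSum_of_card_eq_one (q : ℂ) (π : Perm α) (h : Fintype.card α = 1) :
    (Fintype.card α : ℂ) * (Fintype.card α + 1) * fullCycleSum q π =
      risingFunctional q (Fintype.card α) (oneSubXPerm π).det := by
  obtain ⟨x, hx⟩ := Fintype.card_eq_one_iff.1 h
  have : Unique α := ⟨⟨x⟩, hx⟩
  have hc : ∀ σ : Perm α, cycleCount σ = 1 := fun σ => by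
    rw [Subsingleton.elim σ 1]
    simp [cycleCount]
  rw [det_oneSubXPerm_of_cycleCount_eq_one (hc π), h, pow_one, ← mul_one (1 - X : ℂ[X]),
    risingFunctional_succ_one_sub_X_mul, ← monomial_zero_one, risingFunctional_monomial]
  simp [fullCycleSum, hc, one_add_one_eq_two]

end Enumeration

theorem card_mul_fullCycleSum (q : ℂ) (α : Type*) [Finite α] :
    ∀ [Fintype α] [DecidableEq α] [Nonempty α] (π : Equiv.Perm α),
      (Fintype.card α : ℂ) * (Fintype.card α + 1) * fullCycleSum q π =
        risingFunctional q (Fintype.card α) (oneSubXPerm π).det := by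
  classical
  induction α using Finite.induction_empty_option with
  | of_equiv e ih =>
    intro _ _ _ π
    have := Fintype.ofEquiv _ e.symm
    have := e.nonempty
    rw [← e.permCongr.apply_symm_apply π, fullCycleSum_permCongr, det_oneSubXPerm_permCongr,
      ← Fintype.card_congr e]
    exact ih _
  | h_empty =>
    intro _ _ h
    exact (IsEmpty.false h.some).elim
  | @h_option α _ ih =>
    intro i d _ π
    cases isEmpty_or_nonempty α
    · exact fullCycleSum_of_card_eq_one q π Fintype.card_unique
    · obtain rfl : i = instFintypeOption := Subsingleton.elim _ _
      obtain rfl : d = fun a b => a.instDecidableEq b := Subsingleton.elim _ _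
      have hcast : ((Fintype.card (Option α) : ℕ) : ℂ) = Fintype.card α + 1 := by simp
      rw [hcast, Fintype.card_option, add_assoc, one_add_one_eq_two]
      obtain ⟨τ, rfl⟩ | ⟨τ, x, rfl⟩ := perm_option_cases π
      · exact card_mul_fullCycleSum_optionCongr q τ (ih τ)
      · exact card_mul_fullCycleSum_optionCongr_mul_swap q ih τ x

theorem fullCycleSum_ne_zero {α : Type*} [Fintype α] [DecidableEq α] [Nonempty α]
    {π : Equiv.Perm α} (hπ : cycleCount π = 1) {q : ℂ} (hq : 0 < q.re) : fullCycleSum q π ≠ 0 := by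
  intro h
  have := card_mul_fullCycleSum q α π
  rw [h, mul_zero, det_oneSubXPerm_of_cycleCount_eq_one hπ] at this
  exact risingFunctional_one_sub_X_pow_ne_zero hq Fintype.card_pos this.symm

theorem fullCycleSum_eq_zero_of_aeval_IOPoly_eq_zero {n : ℕ} (hn : 1 ≤ n) {π : Equiv.Perm (Fin n)}
    (hπ : cycleCount π = 1) {q : ℂ} (h : aeval (q ^ 2) (IOPoly π) = 0) :
    fullCycleSum q π = 0 := by
  have : Nonempty (Fin n) := ⟨⟨0, hn⟩⟩
  have hexp : ∀ ζ : Equiv.Perm (Fin n), cycleCount ζ = 1 →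
      cycleCount (π * ζ) = (if Even n then 2 else 1) + 2 * ((cycleCount (π * ζ) - 1) / 2) := by
    intro ζ hζ
    have h1 := even_card_add_cycleCount_mul hπ hζ
    have h2 := cycleCount_pos (π * ζ)
    rw [Fintype.card_fin] at h1
    split_ifs with hn <;> grind
  have : fullCycleSum q π = q ^ (if Even n then 2 else 1) * aeval (q ^ 2) (IOPoly π) := by
    rw [fullCycleSum, IOPoly, map_sum, Finset.mul_sum]
    refine Finset.sum_congr rfl fun ζ hζ => ?_
    rw [map_pow, aeval_X, ← pow_mul, ← pow_add, ← hexp ζ (Finset.mem_filter.1 hζ).2]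
  rw [this, h, mul_zero]

/-- The IO-polynomial of an `n`-cycle is real-rooted: every complex root is real. -/
theorem stmt_13 (n : ℕ) (hn : 1 ≤ n) (π : Equiv.Perm (Fin n)) (hπ : cycleCount π = 1) :
    ∀ z : ℂ, Polynomial.aeval z (IOPoly π) = 0 → z.im = 0 := by
  intro z hz
  have : Nonempty (Fin n) := ⟨⟨0, hn⟩⟩
  obtain ⟨q, rfl⟩ := IsAlgClosed.exists_pow_nat_eq z two_pos
  have h1 : ¬ 0 < q.re := fun hq =>
    fullCycleSum_ne_zero hπ hq (fullCycleSum_eq_zero_of_aeval_IOPoly_eq_zero hn hπ hz)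
  have h2 : ¬ 0 < (-q).re := fun hq =>
    fullCycleSum_ne_zero hπ hq (fullCycleSum_eq_zero_of_aeval_IOPoly_eq_zero hn hπ (by simpa))
  rw [Complex.neg_re] at h2
  have hre : q.re = 0 := by linarith
  simp [sq, hre]
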